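/- Let (A,β) be a braided Hopf algebra over a field k, and let β⁻¹ denote the convolution inverse of β. Then the bilinear form β₂₁⁻¹ defined by β₂₁⁻¹(a,b) = β⁻¹(b,a) is also a braiding on A: it is a convolution-invertible skew pairing on (A,A) satisfying Σ b₁a₁ β₂₁⁻¹(a₂,b₂) = Σ β₂₁⁻¹(a₁,b₁) a₂b₂ for all a,b ∈ A. -/

import Mathlib

/-!
STATEMENT 14: Let (A,β) be a braided Hopf algebra over a field k, with β⁻¹ the convolution
inverse of β.  Then β₂₁⁻¹ defined by β₂₁⁻¹(a,b) = β⁻¹(b,a) is also a braiding on A.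
-/

open TensorProduct Coalgebra LinearMap

noncomputable section

variable {k : Type} [Field k]

/-- Convolution product of linear maps from a coalgebra `C` to an algebra `M`:
`(f * g)(c) = Σ f(c₁) g(c₂)`. -/
def conv {C M : Type} [AddCommGroup C] [Module k C] [Coalgebra k C]
    [Ring M] [Algebra k M] (f g : C →ₗ[k] M) : C →ₗ[k] M :=
  (LinearMap.mul' k M) ∘ₗ (TensorProduct.map f g) ∘ₗ Coalgebra.comul

/-- `Σ g(c₁) • f(c₂)`. -/
def convL {C M : Type} [AddCommGroup C] [Module k C] [Coalgebra k C]
    [AddCommGroup M] [Module k M] (g : C →ₗ[k] k) (f : C →ₗ[k] M) : C →ₗ[k] M :=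
  (TensorProduct.lid k M).toLinearMap ∘ₗ (TensorProduct.map g f) ∘ₗ Coalgebra.comul

/-- `Σ g(c₂) • f(c₁)`. -/
def convR {C M : Type} [AddCommGroup C] [Module k C] [Coalgebra k C]
    [AddCommGroup M] [Module k M] (f : C →ₗ[k] M) (g : C →ₗ[k] k) : C →ₗ[k] M :=
  (TensorProduct.rid k M).toLinearMap ∘ₗ (TensorProduct.map f g) ∘ₗ Coalgebra.comul

/-- Convolution invertibility of a bilinear form. -/
def IsConvInvertible {C : Type} [AddCommGroup C] [Module k C] [Coalgebra k C]
    (τ : C →ₗ[k] k) : Prop :=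
  ∃ τi : C →ₗ[k] k, conv τ τi = Coalgebra.counit ∧ conv τi τ = Coalgebra.counit

/-- A skew pairing on the ordered pair `(A, U)`. -/
structure IsSkewPairing {A U : Type} [Ring A] [Ring U] [HopfAlgebra k A] [HopfAlgebra k U]
    (τ : A ⊗[k] U →ₗ[k] k) : Prop where
  mul_left : ∀ (b c : A) (u : U),
    τ ((b * c) ⊗ₜ u) = conv (τ ∘ₗ TensorProduct.mk k A U b) (τ ∘ₗ TensorProduct.mk k A U c) u
  mul_right : ∀ (b : A) (u v : U),
    τ (b ⊗ₜ (u * v)) =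
      conv (τ ∘ₗ (TensorProduct.mk k A U).flip v) (τ ∘ₗ (TensorProduct.mk k A U).flip u) b
  one_left : ∀ u : U, τ (1 ⊗ₜ u) = Coalgebra.counit u
  one_right : ∀ a : A, τ (a ⊗ₜ 1) = Coalgebra.counit a

/-- A braiding on a Hopf algebra `A`. -/
structure IsBraiding {A : Type} [Ring A] [HopfAlgebra k A] (β : A ⊗[k] A →ₗ[k] k) : Prop where
  skew : IsSkewPairing β
  invertible : IsConvInvertible β
  compat : ∀ a b : A,
    convR ((LinearMap.mul' k A) ∘ₗ (TensorProduct.comm k A A).toLinearMap) β (a ⊗ₜ b)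
      = convL β (LinearMap.mul' k A) (a ⊗ₜ b)

variable {A : Type} [Ring A] [HopfAlgebra k A]

namespace Coalgebra.TensorProduct

variable (U V W : Type) [AddCommGroup U] [AddCommGroup V] [AddCommGroup W]
  [Module k U] [Module k V] [Module k W] [Coalgebra k U] [Coalgebra k V] [Coalgebra k W]

/-- The swap `U ⊗ V → V ⊗ U` as a coalgebra homomorphism. -/
def swapCoalgHom : U ⊗[k] V →ₗc[k] V ⊗[k] U where
  toLinearMap := (TensorProduct.comm k U V).toLinearMap
  counit_comp := by
    ext u v
    simp [mul_comm]
  map_comp_comul := by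
    ext u v
    simp [← (ℛ k u).eq, ← (ℛ k v).eq, TensorProduct.sum_tmul, TensorProduct.tmul_sum]
    exact Finset.sum_comm

/-- The coalgebra homomorphism `u ⊗ v ⊗ w ↦ ε(w) u ⊗ v`. -/
def projLeft : U ⊗[k] (V ⊗[k] W) →ₗc[k] U ⊗[k] V :=
  Coalgebra.TensorProduct.map (CoalgHom.id k U)
    ((Coalgebra.TensorProduct.rid k k V : V ⊗[k] k →ₗc[k] V).comp
      (Coalgebra.TensorProduct.map (CoalgHom.id k V) (Coalgebra.counitCoalgHom k W)))

/-- The coalgebra homomorphism `u ⊗ v ⊗ w ↦ ε(v) u ⊗ w`. -/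
def projRight : U ⊗[k] (V ⊗[k] W) →ₗc[k] U ⊗[k] W :=
  (projLeft U W V).comp (Coalgebra.TensorProduct.map (CoalgHom.id k U) (swapCoalgHom V W))

variable {U V W}

@[simp]
lemma projLeft_tmul (u : U) (v : V) (w : W) :
    projLeft U V W (u ⊗ₜ[k] (v ⊗ₜ[k] w)) = u ⊗ₜ (counit (R := k) w • v) := rfl

@[simp]
lemma projRight_tmul (u : U) (v : V) (w : W) :
    projRight U V W (u ⊗ₜ[k] (v ⊗ₜ[k] w)) = u ⊗ₜ (counit (R := k) v • w) := rfl

lemma sum_smul_counit {ι : Type*} {u : U} (r : Coalgebra.Repr k u ι) :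
    ∑ i ∈ r.index, counit (R := k) (r.right i) • r.left i = u := by
  simpa only [map_sum, _root_.TensorProduct.rid_tmul, one_smul]
    using congr(_root_.TensorProduct.rid k U $(sum_tmul_counit_eq (R := k) r))

lemma projRight_comp_map_swap :
    (projRight U V W).toLinearMap ∘ₗ (Coalgebra.TensorProduct.map (CoalgHom.id k U)
      (swapCoalgHom W V)).toLinearMap = (projLeft U W V).toLinearMap := by
  ext
  rfl

/-- Tensoring with a fixed grouplike element is a coalgebra homomorphism. -/
def tmulCoalgHom (v : V) (hv : IsGroupLikeElem k v) : U →ₗc[k] U ⊗[k] V where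
  toLinearMap := (TensorProduct.mk k U V).flip v
  counit_comp := by
    ext u
    simp [hv.counit_eq_one]
  map_comp_comul := by
    ext u
    simp [← (ℛ k u).eq, hv.comul_eq_tmul_self, TensorProduct.sum_tmul]

lemma map_projLeft_projRight_comul (u : U) (v : V) (w : W) :
    _root_.TensorProduct.map (projLeft U V W).toLinearMap (projRight U V W).toLinearMap
        (comul (R := k) (u ⊗ₜ[k] (v ⊗ₜ[k] w))) =
      _root_.TensorProduct.map ((TensorProduct.mk k U V).flip v) ((TensorProduct.mk k U W).flip w)
        (comul u) := by
  have hv := sum_smul_counit (ℛ k v)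
  have hw := sum_counit_smul (ℛ k w)
  simp only [← (ℛ k u).eq, ← (ℛ k v).eq, ← (ℛ k w).eq, TensorProduct.sum_tmul,
    TensorProduct.tmul_sum, TensorProduct.comul_tmul, map_sum,
    AlgebraTensorModule.tensorTensorTensorComm_tmul, _root_.TensorProduct.map_tmul,
    CoalgHom.toLinearMap_eq_coe, CoalgHom.coe_toLinearMap, projLeft_tmul, projRight_tmul,
    LinearMap.flip_apply, TensorProduct.mk_apply]
  rw [Finset.sum_comm_cycle]
  refine Finset.sum_congr rfl fun i _ => ?_
  conv_rhs => rw [← hv, ← hw]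
  simp only [TensorProduct.sum_tmul, TensorProduct.tmul_sum, TensorProduct.tmul_smul,
    ← TensorProduct.smul_tmul', Finset.smul_sum]
  exact Finset.sum_congr rfl fun _ _ => Finset.sum_congr rfl fun _ _ => smul_comm _ _ _

end Coalgebra.TensorProduct

open Coalgebra.TensorProduct WithConv

section Convolution

variable {C D : Type} [AddCommGroup C] [AddCommGroup D] [Module k C] [Module k D]
  [Coalgebra k C] [Coalgebra k D] {M : Type} [Ring M] [Algebra k M]

lemma conv_comp_coalgHom (f g : C →ₗ[k] M) (F : D →ₗc[k] C) :
    conv f g ∘ₗ F.toLinearMap = conv (f ∘ₗ F.toLinearMap) (g ∘ₗ F.toLinearMap) :=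
  convMul_comp_coalgHom_distrib (toConv f) (toConv g) F

lemma conv_comp_coalgHom_eq_counit {f g : C →ₗ[k] k} (h : conv f g = counit) (F : D →ₗc[k] C) :
    conv (f ∘ₗ F.toLinearMap) (g ∘ₗ F.toLinearMap) = counit := by
  rw [← conv_comp_coalgHom, h, F.counit_comp]

lemma convL_eq_conv (f : C →ₗ[k] k) (g : C →ₗ[k] M) :
    convL f g = conv (Algebra.linearMap k M ∘ₗ f) g := by
  ext c
  simp [convL, conv, ← (ℛ k c).eq, Algebra.smul_def]

lemma convR_eq_conv (f : C →ₗ[k] M) (g : C →ₗ[k] k) :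
    convR f g = conv f (Algebra.linearMap k M ∘ₗ g) := by
  ext c
  simp [convR, conv, ← (ℛ k c).eq, Algebra.smul_def, Algebra.commutes]

lemma linearMap_comp_mul_eq_one {f g : C →ₗ[k] k} (h : conv f g = counit) :
    toConv (Algebra.linearMap k M ∘ₗ f) * toConv (Algebra.linearMap k M ∘ₗ g) = 1 := by
  refine (congrArg toConv (algHom_comp_convMul_distrib (Algebra.ofId k M)
    (toConv f) (toConv g))).symm.trans ?_
  exact congrArg (fun e : C →ₗ[k] k => toConv (Algebra.linearMap k M ∘ₗ e)) h

/-- If `h * f = f * h'` and `g` is the convolution inverse of `f`, then `h' * g = g * h`. -/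
lemma convR_eq_convL_of_inverse {f g : C →ₗ[k] k} {h h' : C →ₗ[k] M}
    (hfg : conv f g = counit) (hgf : conv g f = counit) (hf : convR h f = convL f h') :
    convR h' g = convL g h := by
  rw [convR_eq_conv, convL_eq_conv] at hf ⊢
  let u : (WithConv (C →ₗ[k] M))ˣ :=
    ⟨_, _, linearMap_comp_mul_eq_one hfg, linearMap_comp_mul_eq_one hgf⟩
  have hu : SemiconjBy (u : WithConv (C →ₗ[k] M)) (toConv h') (toConv h) :=
    congrArg toConv hf.symm
  exact congrArg ofConv hu.units_inv_symm_left.symm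

end Convolution

section BilinearForm

variable {U V : Type} [AddCommGroup U] [AddCommGroup V] [Module k U] [Module k V]
  [Coalgebra k U] [Coalgebra k V]

lemma conv_projLeft_projRight (σ τ : U ⊗[k] V →ₗ[k] k) (u : U) (v w : V) :
    conv (σ ∘ₗ (projLeft U V V).toLinearMap) (τ ∘ₗ (projRight U V V).toLinearMap)
        (u ⊗ₜ[k] (v ⊗ₜ[k] w)) =
      conv (σ ∘ₗ (TensorProduct.mk k U V).flip v) (τ ∘ₗ (TensorProduct.mk k U V).flip w) u := by
  simp only [conv, LinearMap.comp_apply, _root_.TensorProduct.map_comp,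
    map_projLeft_projRight_comul]

lemma conv_projRight_projLeft (σ τ : U ⊗[k] V →ₗ[k] k) (u : U) (v w : V) :
    conv (σ ∘ₗ (projRight U V V).toLinearMap) (τ ∘ₗ (projLeft U V V).toLinearMap)
        (u ⊗ₜ[k] (v ⊗ₜ[k] w)) =
      conv (σ ∘ₗ (TensorProduct.mk k U V).flip w) (τ ∘ₗ (TensorProduct.mk k U V).flip v) u := by
  let S := Coalgebra.TensorProduct.map (CoalgHom.id k U) (swapCoalgHom (k := k) V V)
  have hL : (projLeft U V V).toLinearMap ∘ₗ S.toLinearMap = (projRight U V V).toLinearMap := rfl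
  have hR : (projRight U V V).toLinearMap ∘ₗ S.toLinearMap = (projLeft U V V).toLinearMap :=
    projRight_comp_map_swap
  have h := conv_comp_coalgHom (σ ∘ₗ (projLeft U V V).toLinearMap)
    (τ ∘ₗ (projRight U V V).toLinearMap) S
  rw [LinearMap.comp_assoc, LinearMap.comp_assoc, hL, hR] at h
  rw [← conv_projLeft_projRight, ← h]
  rfl

/-- If `τ(u, m(v, w)) = Σ τ(u₁, v) τ(u₂, w)` for a coalgebra homomorphism `m`, then the convolution
inverse `σ` of `τ` satisfies `σ(u, m(v, w)) = Σ σ(u₁, w) σ(u₂, v)`. -/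
lemma inverse_apply_tmul_coalgHom {σ τ : U ⊗[k] V →ₗ[k] k} (hστ : conv σ τ = counit)
    (hτσ : conv τ σ = counit) (m : V ⊗[k] V →ₗc[k] V)
    (hτ : ∀ u v w, τ (u ⊗ₜ m (v ⊗ₜ w)) =
      conv (τ ∘ₗ (TensorProduct.mk k U V).flip v) (τ ∘ₗ (TensorProduct.mk k U V).flip w) u)
    (u : U) (v w : V) :
    σ (u ⊗ₜ m (v ⊗ₜ w)) =
      conv (σ ∘ₗ (TensorProduct.mk k U V).flip w) (σ ∘ₗ (TensorProduct.mk k U V).flip v) u := by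
  let F : U ⊗[k] (V ⊗[k] V) →ₗc[k] U ⊗[k] V :=
    Coalgebra.TensorProduct.map (CoalgHom.id k U) m
  let L := projLeft (k := k) U V V
  let R := projRight (k := k) U V V
  have hF : τ ∘ₗ F.toLinearMap = conv (τ ∘ₗ L.toLinearMap) (τ ∘ₗ R.toLinearMap) := by
    ext u v w
    exact (hτ u v w).trans (conv_projLeft_projRight τ τ u v w).symm
  have hleft : toConv (σ ∘ₗ F.toLinearMap) * toConv (τ ∘ₗ F.toLinearMap) = 1 :=
    congrArg toConv (conv_comp_coalgHom_eq_counit hστ F)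
  have hL : toConv (τ ∘ₗ L.toLinearMap) * toConv (σ ∘ₗ L.toLinearMap) = 1 :=
    congrArg toConv (conv_comp_coalgHom_eq_counit hτσ L)
  have hR : toConv (τ ∘ₗ R.toLinearMap) * toConv (σ ∘ₗ R.toLinearMap) = 1 :=
    congrArg toConv (conv_comp_coalgHom_eq_counit hτσ R)
  have hright : toConv (τ ∘ₗ F.toLinearMap) *
      (toConv (σ ∘ₗ R.toLinearMap) * toConv (σ ∘ₗ L.toLinearMap)) = 1 := by
    have hF' : toConv (τ ∘ₗ F.toLinearMap) =
        toConv (τ ∘ₗ L.toLinearMap) * toConv (τ ∘ₗ R.toLinearMap) := congrArg toConv hF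
    rw [hF', mul_assoc, ← mul_assoc (toConv (τ ∘ₗ R.toLinearMap)), hR, one_mul, hL]
  have h : σ ∘ₗ F.toLinearMap = conv (σ ∘ₗ R.toLinearMap) (σ ∘ₗ L.toLinearMap) :=
    congrArg ofConv (left_inv_eq_right_inv hleft hright)
  rw [← conv_projRight_projLeft, ← h]
  rfl

/-- If `τ(u, v) = ε(u)` for a grouplike `v`, then the same holds for the convolution inverse. -/
lemma inverse_apply_tmul_of_isGroupLike {σ τ : U ⊗[k] V →ₗ[k] k} (hστ : conv σ τ = counit)
    {v : V} (hv : IsGroupLikeElem k v) (hτ : ∀ u, τ (u ⊗ₜ v) = counit (R := k) u) (u : U) :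
    σ (u ⊗ₜ v) = counit (R := k) u := by
  have h := conv_comp_coalgHom_eq_counit hστ (tmulCoalgHom (U := U) v hv)
  have hτ' : τ ∘ₗ (tmulCoalgHom (U := U) v hv).toLinearMap = counit := LinearMap.ext hτ
  rw [hτ'] at h
  have h' := (mul_one (toConv (σ ∘ₗ (tmulCoalgHom (U := U) v hv).toLinearMap))).symm.trans
    (congrArg toConv h)
  exact LinearMap.congr_fun (congrArg ofConv h') u

end BilinearForm

/-- `β₂₁⁻¹(a,b) = β⁻¹(b,a)` is a braiding on `A`. -/
theorem inv_twentyone_isBraiding (β : A ⊗[k] A →ₗ[k] k) (hβ : IsBraiding β)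
    (βi : A ⊗[k] A →ₗ[k] k)
    (hinv₁ : conv β βi = Coalgebra.counit) (hinv₂ : conv βi β = Coalgebra.counit) :
    IsBraiding (βi ∘ₗ (TensorProduct.comm k A A).toLinearMap) := by
  let s := swapCoalgHom (k := k) A A
  let μ := Bialgebra.mulCoalgHom k A
  have hinv₁' : conv (β ∘ₗ s.toLinearMap) (βi ∘ₗ s.toLinearMap) = counit :=
    conv_comp_coalgHom_eq_counit hinv₁ s
  have hinv₂' : conv (βi ∘ₗ s.toLinearMap) (β ∘ₗ s.toLinearMap) = counit :=
    conv_comp_coalgHom_eq_counit hinv₂ s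
  refine ⟨⟨?_, ?_, ?_, ?_⟩, ⟨_, hinv₂', hinv₁'⟩, ?_⟩
  · intro b c u
    exact inverse_apply_tmul_coalgHom hinv₂ hinv₁ (μ.comp s)
      (fun u v w => hβ.skew.mul_right u w v) u c b
  · intro b u v
    exact inverse_apply_tmul_coalgHom hinv₂' hinv₁' μ
      (fun u v w => hβ.skew.mul_left v w u) b u v
  · exact inverse_apply_tmul_of_isGroupLike hinv₂ .one hβ.skew.one_right
  · exact inverse_apply_tmul_of_isGroupLike hinv₂' .one hβ.skew.one_left
  · have hcompat : convR (LinearMap.mul' k A) (β ∘ₗ s.toLinearMap) =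
        convL (β ∘ₗ s.toLinearMap) (LinearMap.mul' k A ∘ₗ s.toLinearMap) := by
      have h : convR (LinearMap.mul' k A ∘ₗ s.toLinearMap) β = convL β (LinearMap.mul' k A) :=
        TensorProduct.ext' hβ.compat
      rw [convR_eq_conv, convL_eq_conv] at h ⊢
      have h' := congrArg (· ∘ₗ s.toLinearMap) h
      simp only [conv_comp_coalgHom] at h'
      have hs : (LinearMap.mul' k A ∘ₗ s.toLinearMap) ∘ₗ s.toLinearMap = LinearMap.mul' k A := by
        ext
        rfl
      rwa [hs] at h'
    intro a b
    exact LinearMap.congr_fun (convR_eq_convL_of_inverse hinv₁' hinv₂' hcompat) (a ⊗ₜ b)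

end
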